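/- Let k ≥ 2, s ≥ 3, and λ ≥ 1. There exists A_0 = A_0(k) such that for every tuple a = (a_1,…,a_s) of nonzero integers with |a| ≥ A_0: if the equation a_1 x_1^k + … + a_s x_s^k = 0 has a solution in primes x_1,…,x_s with x_j > |a|^λ for all j, then a ∈ C'(k,s). -/

import Mathlib

open scoped BigOperators Classical
open Filter

noncomputable section

/-- `hgt a = max_j |a_j|` as a real number. -/
def hgt {s : ℕ} (a : Fin s → ℤ) : ℝ :=
  ((Finset.univ.sup fun j => (a j).natAbs : ℕ) : ℝ)

/-- Solubility of `∑ a_j x_j^k = 0` in positive reals. -/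
def solRplus (k : ℕ) {s : ℕ} (a : Fin s → ℤ) : Prop :=
  ∃ x : Fin s → ℝ, (∀ j, 0 < x j) ∧ ∑ j, (a j : ℝ) * x j ^ k = 0

/-- Solubility of `∑ a_j x_j^k = 0` in `p`-adic units. -/
def solZpUnit (k : ℕ) {s : ℕ} (p : ℕ) [Fact p.Prime] (a : Fin s → ℤ) : Prop :=
  ∃ x : Fin s → ℤ_[p], (∀ j, IsUnit (x j)) ∧ ∑ j, (a j : ℤ_[p]) * x j ^ k = 0

/-- `a ∈ C'(k,s)`: real-positive solubility together with solubility in `p`-adic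
units for every prime `p`. -/
def memC' (k : ℕ) {s : ℕ} (a : Fin s → ℤ) : Prop :=
  solRplus k a ∧ ∀ (p : ℕ) [Fact p.Prime], solZpUnit k p a


/-- The exponential sum `∑ ψ(t x^k)` over the nonzero residues `x` modulo `p`. -/
def unitPowSum (p k : ℕ) [Fact p.Prime] (t : ZMod p) : ℂ :=
  ∑ x : (ZMod p)ˣ, ZMod.stdAddChar (t * (x : ZMod p) ^ k)

theorem card_units_mul_pow_eq_le {p k : ℕ} [Fact p.Prime] (hk : 0 < k) {t : ZMod p}
    (ht : t ≠ 0) (b : ZMod p) :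
    (Finset.univ.filter fun x : (ZMod p)ˣ => t * (x : ZMod p) ^ k = b).card ≤ k := by
  calc _ ≤ (Polynomial.nthRoots k (b / t)).toFinset.card := by
        refine Finset.card_le_card_of_injOn (fun x : (ZMod p)ˣ => (x : ZMod p)) ?_
          (fun x _ y _ h => Units.ext h)
        intro x hx
        have hx' : t * (x : ZMod p) ^ k = b := by simpa using hx
        simp only [Finset.mem_coe, Multiset.mem_toFinset, Polynomial.mem_nthRoots hk]
        rw [eq_div_iff ht, mul_comm, hx']
    _ ≤ Multiset.card (Polynomial.nthRoots k (b / t)) := Multiset.toFinset_card_le _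
    _ ≤ k := Polynomial.card_nthRoots k _

theorem sum_norm_sq_unitPowSum {p k : ℕ} [Fact p.Prime] :
    ∑ t : ZMod p, ‖unitPowSum p k t‖ ^ 2 =
      p * ∑ y : (ZMod p)ˣ, ((Finset.univ.filter fun x : (ZMod p)ˣ =>
        1 * (x : ZMod p) ^ k = (y : ZMod p) ^ k).card : ℝ) := by
  have h : ∀ t : ZMod p, ((‖unitPowSum p k t‖ ^ 2 : ℝ) : ℂ) =
      ∑ y : (ZMod p)ˣ, ∑ x : (ZMod p)ˣ,
        ZMod.stdAddChar (t * ((x : ZMod p) ^ k - (y : ZMod p) ^ k)) := by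
    intro t
    push_cast
    rw [← Complex.mul_conj', unitPowSum, map_sum, Finset.sum_mul_sum, Finset.sum_comm]
    refine Finset.sum_congr rfl fun y _ => Finset.sum_congr rfl fun x _ => ?_
    rw [← AddChar.map_neg_eq_conj, ← AddChar.map_add_eq_mul]
    congr 1
    ring
  have h2 : ((∑ t : ZMod p, ‖unitPowSum p k t‖ ^ 2 : ℝ) : ℂ) =
      ((p * ∑ y : (ZMod p)ˣ, ((Finset.univ.filter fun x : (ZMod p)ˣ =>
        1 * (x : ZMod p) ^ k = (y : ZMod p) ^ k).card : ℝ) : ℝ) : ℂ) := by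
    rw [Complex.ofReal_sum, Finset.sum_congr rfl fun t _ => h t, Finset.sum_comm]
    push_cast
    rw [Finset.mul_sum]
    refine Finset.sum_congr rfl fun y _ => ?_
    rw [Finset.sum_comm]
    simp only [AddChar.sum_mulShift _ (ZMod.isPrimitive_stdAddChar p), sub_eq_zero, ZMod.card,
      one_mul]
    rw [Finset.card_filter]
    push_cast
    rw [Finset.mul_sum]
    refine Finset.sum_congr rfl fun x _ => ?_
    split_ifs <;> simp
  exact_mod_cast h2

theorem sum_norm_sq_unitPowSum_le {p k : ℕ} [Fact p.Prime] (hk : 0 < k) :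
    ∑ t : ZMod p, ‖unitPowSum p k t‖ ^ 2 ≤ p * ((p - 1) * k) := by
  rw [sum_norm_sq_unitPowSum]
  gcongr
  calc _ ≤ ∑ y : (ZMod p)ˣ, (k : ℝ) := by
        refine Finset.sum_le_sum fun y _ => ?_
        exact_mod_cast card_units_mul_pow_eq_le hk one_ne_zero _
    _ = (p - 1) * k := by
        have := (Fact.out : p.Prime).one_le
        rw [Finset.sum_const, Finset.card_univ, ZMod.card_units, nsmul_eq_mul]
        push_cast [this]
        rfl

theorem unitPowSum_mul_pow {p k : ℕ} [Fact p.Prime] (t : ZMod p) (u : (ZMod p)ˣ) :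
    unitPowSum p k (t * (u : ZMod p) ^ k) = unitPowSum p k t := by
  unfold unitPowSum
  refine Fintype.sum_equiv (Equiv.mulLeft u) _ _ fun x => ?_
  simp only [Equiv.coe_mulLeft, Units.val_mul]
  congr 1
  ring

theorem norm_unitPowSum_le {p k : ℕ} [Fact p.Prime] (hk : 0 < k) {t : ZMod p} (ht : t ≠ 0) :
    ‖unitPowSum p k t‖ ^ 2 ≤ k ^ 2 * p := by
  have hp : (1 : ℝ) < p := by exact_mod_cast (Fact.out : p.Prime).one_lt
  have hsum : ∑ u : (ZMod p)ˣ, ‖unitPowSum p k (t * (u : ZMod p) ^ k)‖ ^ 2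
      = (p - 1) * ‖unitPowSum p k t‖ ^ 2 := by
    simp only [unitPowSum_mul_pow]
    have := (Fact.out : p.Prime).one_le
    rw [Finset.sum_const, Finset.card_univ, ZMod.card_units, nsmul_eq_mul]
    push_cast [this]
    rfl
  have hfib : ∑ u : (ZMod p)ˣ, ‖unitPowSum p k (t * (u : ZMod p) ^ k)‖ ^ 2
      ≤ ∑ b : ZMod p, k * ‖unitPowSum p k b‖ ^ 2 := by
    rw [← Finset.sum_fiberwise_of_maps_to (s := Finset.univ) (t := Finset.univ)
      (g := fun u : (ZMod p)ˣ => t * (u : ZMod p) ^ k) (fun _ _ => Finset.mem_univ _)]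
    refine Finset.sum_le_sum fun b _ => ?_
    calc _ = ∑ u ∈ Finset.univ.filter (fun u : (ZMod p)ˣ => t * (u : ZMod p) ^ k = b),
            ‖unitPowSum p k b‖ ^ 2 :=
          Finset.sum_congr rfl fun u hu => by rw [(Finset.mem_filter.mp hu).2]
      _ ≤ k * ‖unitPowSum p k b‖ ^ 2 := by
          rw [Finset.sum_const, nsmul_eq_mul]
          gcongr
          exact card_units_mul_pow_eq_le hk ht b
  rw [← Finset.mul_sum] at hfib
  have h1 := sum_norm_sq_unitPowSum_le (p := p) hk
  have hk' : (0 : ℝ) ≤ k := by positivity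
  have h2 := mul_le_mul_of_nonneg_left h1 hk'
  refine le_of_mul_le_mul_left (a := (p : ℝ) - 1) ?_ (by linarith)
  nlinarith

/-- Three nonzero coefficients already represent every residue by `k`-th powers of nonzero
residues, once `p` is large in terms of `k`. -/
theorem exists_units_sum_three_pow {p k : ℕ} [Fact p.Prime] (hk : 0 < k)
    (hp : 16 * k ^ 6 < p) {a b d : ZMod p} (ha : a ≠ 0) (hb : b ≠ 0) (hd : d ≠ 0)
    (c : ZMod p) : ∃ x y z : (ZMod p)ˣ,
      a * (x : ZMod p) ^ k + b * (y : ZMod p) ^ k + d * (z : ZMod p) ^ k = c := by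
  by_contra! hno
  have hp1 : 2 ≤ p := (Fact.out : p.Prime).two_le
  have hp2 : (2 : ℝ) ≤ p := by exact_mod_cast hp1
  set f : ZMod p → ℂ := fun t => unitPowSum p k (t * a) * unitPowSum p k (t * b) *
    unitPowSum p k (t * d) * ZMod.stdAddChar (-(t * c)) with hf
  have htot : ∑ t, f t = 0 := by
    have h : ∀ t, f t = ∑ x : (ZMod p)ˣ, ∑ y : (ZMod p)ˣ, ∑ z : (ZMod p)ˣ,
        ZMod.stdAddChar (t * (a * (x : ZMod p) ^ k + b * (y : ZMod p) ^ k
          + d * (z : ZMod p) ^ k - c)) := by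
      intro t
      simp only [hf, unitPowSum]
      rw [Finset.sum_mul_sum, Finset.sum_mul, Finset.sum_mul]
      refine Finset.sum_congr rfl fun x _ => ?_
      rw [Finset.sum_mul, Finset.sum_mul]
      refine Finset.sum_congr rfl fun y _ => ?_
      rw [Finset.mul_sum, Finset.sum_mul]
      refine Finset.sum_congr rfl fun z _ => ?_
      rw [← AddChar.map_add_eq_mul, ← AddChar.map_add_eq_mul, ← AddChar.map_add_eq_mul]
      congr 1
      ring
    rw [Finset.sum_congr rfl fun t _ => h t, Finset.sum_comm]
    refine Finset.sum_eq_zero fun x _ => ?_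
    rw [Finset.sum_comm]
    refine Finset.sum_eq_zero fun y _ => ?_
    rw [Finset.sum_comm]
    refine Finset.sum_eq_zero fun z _ => ?_
    rw [AddChar.sum_mulShift _ (ZMod.isPrimitive_stdAddChar p),
      if_neg (sub_ne_zero.mpr (hno x y z)), Nat.cast_zero]
  have hzero : f 0 = ((p : ℂ) - 1) ^ 3 := by
    have h : unitPowSum p k 0 = (p : ℂ) - 1 := by
      simp [unitPowSum, Nat.totient_prime (Fact.out : p.Prime), (Fact.out : p.Prime).one_le]
    simp only [hf, zero_mul, h, neg_zero, AddChar.map_zero_eq_one, mul_one]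
    ring
  have hbound : ∀ t ∈ Finset.univ.erase (0 : ZMod p), ‖f t‖ ≤ (k * √p) ^ 3 := by
    intro t ht
    have ht0 : t ≠ 0 := Finset.ne_of_mem_erase ht
    have h : ∀ e : ZMod p, e ≠ 0 → ‖unitPowSum p k (t * e)‖ ≤ k * √p := by
      intro e he
      refine abs_le_of_sq_le_sq' ?_ (by positivity) |>.2
      rw [mul_pow, Real.sq_sqrt (by positivity)]
      exact norm_unitPowSum_le hk (mul_ne_zero ht0 he)
    simp only [hf, norm_mul, AddChar.norm_apply, mul_one]
    calc _ ≤ (k * √p) * (k * √p) * (k * √p) := by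
          gcongr
          exacts [h a ha, h b hb, h d hd]
      _ = _ := by ring
  have hmain : ((p : ℝ) - 1) ^ 3 ≤ (p - 1) * (k * √p) ^ 3 := by
    have h1 : f 0 = -∑ t ∈ Finset.univ.erase (0 : ZMod p), f t := by
      rw [← Finset.add_sum_erase _ f (Finset.mem_univ 0)] at htot
      exact eq_neg_of_add_eq_zero_left htot
    have h2 : ‖f 0‖ = ((p : ℝ) - 1) ^ 3 := by
      have h3 : f 0 = ((((p : ℝ) - 1) ^ 3 : ℝ) : ℂ) := by rw [hzero]; push_cast; rfl
      rw [h3, Complex.norm_real, Real.norm_of_nonneg (pow_nonneg (by linarith) 3)]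
    rw [← h2, h1, norm_neg]
    refine (norm_sum_le_of_le _ hbound).trans (le_of_eq ?_)
    rw [Finset.sum_const, Finset.card_erase_of_mem (Finset.mem_univ _), Finset.card_univ,
      ZMod.card, nsmul_eq_mul, Nat.cast_sub (by omega), Nat.cast_one]
  have hsq : ((p : ℝ) - 1) ^ 2 ≤ (k * √p) ^ 3 :=
    le_of_mul_le_mul_left (by linarith [hmain, pow_succ' ((p : ℝ) - 1) 2])
      (show (0 : ℝ) < p - 1 by linarith)
  have hfour : ((p : ℝ) - 1) ^ 4 ≤ k ^ 6 * p ^ 3 := by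
    calc ((p : ℝ) - 1) ^ 4 = (((p : ℝ) - 1) ^ 2) ^ 2 := by ring
      _ ≤ ((k * √p) ^ 3) ^ 2 := by gcongr
      _ = k ^ 6 * (√p ^ 2) ^ 3 := by ring
      _ = k ^ 6 * p ^ 3 := by rw [Real.sq_sqrt (by positivity)]
  have hhalf : ((p : ℝ) / 2) ^ 4 ≤ (p - 1) ^ 4 := by
    gcongr
    linarith
  have hpk : (16 * k ^ 6 : ℝ) < p := by exact_mod_cast hp
  have hp3 : (0 : ℝ) < (p : ℝ) ^ 3 := by positivity
  nlinarith [mul_lt_mul_of_pos_right hpk hp3]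

theorem isUnit_iff_toZMod_ne_zero {p : ℕ} [Fact p.Prime] (x : ℤ_[p]) :
    IsUnit x ↔ PadicInt.toZMod x ≠ 0 := by
  rw [← not_iff_not, not_not, ← RingHom.mem_ker, PadicInt.ker_toZMod,
    IsLocalRing.mem_maximalIdeal, mem_nonunits_iff]

theorem exists_unit_mul_pow_eq {p k : ℕ} [Fact p.Prime] (hk : 0 < k) (hkp : k < p)
    {a c : ℤ_[p]} (ha : IsUnit a) {u : (ZMod p)ˣ}
    (hu : PadicInt.toZMod a * (u : ZMod p) ^ k = PadicInt.toZMod c) :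
    ∃ z : ℤ_[p], IsUnit z ∧ a * z ^ k = c := by
  have hunit := isUnit_iff_toZMod_ne_zero (p := p)
  obtain ⟨x, hx⟩ := ZMod.ringHom_surjective (PadicInt.toZMod (p := p)) (u : ZMod p)
  have hxu : IsUnit x := (hunit x).2 (by rw [hx]; exact u.ne_zero)
  have hku : IsUnit (k : ℤ_[p]) := by
    rw [hunit, map_natCast, Ne, ZMod.natCast_eq_zero_iff]
    exact Nat.not_dvd_of_pos_of_lt hk hkp
  set F : Polynomial ℤ_[p] := Polynomial.C a * Polynomial.X ^ k - Polynomial.C c with hF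
  have hev : ∀ z : ℤ_[p], F.aeval z = a * z ^ k - c := fun z => by simp [hF]
  have hder : ‖F.derivative.aeval x‖ = 1 := by
    rw [← PadicInt.isUnit_iff]
    have : F.derivative.aeval x = a * (k * x ^ (k - 1)) := by
      simp [hF, Polynomial.derivative_X_pow]
    rw [this]
    exact ha.mul (hku.mul (hxu.pow _))
  have hlt : ‖F.aeval x‖ < ‖F.derivative.aeval x‖ ^ 2 := by
    rw [hder, one_pow, ← PadicInt.not_isUnit_iff, hunit, not_not, hev, map_sub, map_mul, map_pow,
      hx, hu, sub_self]
  obtain ⟨z, hz, hzx, -⟩ := hensels_lemma hlt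
  rw [hder, ← PadicInt.not_isUnit_iff, hunit, not_not, map_sub, sub_eq_zero] at hzx
  refine ⟨z, (hunit z).2 ?_, sub_eq_zero.1 (by rw [← hev, hz])⟩
  rw [hzx, hx]
  exact u.ne_zero

theorem solZpUnit_of_not_dvd {k s p : ℕ} [Fact p.Prime] (hk : 0 < k) (hs : 3 ≤ s)
    (hp : 16 * k ^ 6 < p) (a : Fin s → ℤ) (ha : ∀ j, ¬ (p : ℤ) ∣ a j) : solZpUnit k p a := by
  obtain ⟨n, rfl⟩ := Nat.exists_eq_add_of_le' hs
  have hkp : k < p := by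
    have : k ≤ k ^ 6 := Nat.le_self_pow (by norm_num) k
    omega
  have ha' : ∀ j, (a j : ZMod p) ≠ 0 := fun j h =>
    ha j ((ZMod.intCast_zmod_eq_zero_iff_dvd _ p).1 h)
  set r : ℤ := ∑ i : Fin n, a i.succ.succ.succ with hr
  obtain ⟨x, y, z, hxyz⟩ := exists_units_sum_three_pow hk hp (ha' 0) (ha' 1) (ha' 2)
    (-(r : ZMod p))
  have hunit := isUnit_iff_toZMod_ne_zero (p := p)
  obtain ⟨y', hy⟩ := ZMod.ringHom_surjective (PadicInt.toZMod (p := p)) (y : ZMod p)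
  obtain ⟨z', hz⟩ := ZMod.ringHom_surjective (PadicInt.toZMod (p := p)) (z : ZMod p)
  obtain ⟨x', hx', hsol⟩ := exists_unit_mul_pow_eq (a := (a 0 : ℤ_[p]))
    (c := -(r : ℤ_[p]) - a 1 * y' ^ k - a 2 * z' ^ k) hk hkp
    ((hunit _).2 (by rw [map_intCast]; exact ha' 0)) (u := x)
    (by simp only [map_sub, map_neg, map_mul, map_pow, map_intCast, hy, hz, ← hxyz]; ring)
  refine ⟨Fin.cons x' (Fin.cons y' (Fin.cons z' fun _ => 1)), ?_, ?_⟩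
  · refine Fin.cases hx' (Fin.cases ?_ (Fin.cases ?_ fun i => ?_))
    · exact (hunit y').2 (by rw [hy]; exact y.ne_zero)
    · exact (hunit z').2 (by rw [hz]; exact z.ne_zero)
    · simp
  · rw [Fin.sum_univ_succ, Fin.sum_univ_succ, Fin.sum_univ_succ]
    simp only [Fin.cons_zero, Fin.cons_succ, one_pow, mul_one, hsol, hr]
    push_cast
    have h1 : (Fin.succ 0 : Fin (n + 3)) = 1 := rfl
    have h2 : (Fin.succ (Fin.succ 0) : Fin (n + 3)) = 2 := rfl
    rw [h1, h2]
    ring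

theorem stmt8 (k : ℕ) (hk : 2 ≤ k) :
    ∃ A₀ : ℝ, ∀ s : ℕ, 3 ≤ s → ∀ lam : ℝ, 1 ≤ lam →
      ∀ a : Fin s → ℤ, (∀ j, a j ≠ 0) → A₀ ≤ hgt a →
        (∃ x : Fin s → ℕ, (∀ j, (x j).Prime) ∧
            (∀ j, hgt a ^ lam < (x j : ℝ)) ∧
            ∑ j, a j * (x j : ℤ) ^ k = 0) →
        memC' k a := by
  refine ⟨16 * (k : ℝ) ^ 6 + 1, ?_⟩
  rintro s hs lam hlam a ha hA ⟨x, hxp, hxl, hsum⟩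
  have hone : 1 ≤ hgt a := le_trans (by linarith [show (0 : ℝ) ≤ (k : ℝ) ^ 6 by positivity]) hA
  have hlt : ∀ j, hgt a < x j := fun j =>
    (Real.self_le_rpow_of_one_le hone hlam).trans_lt (hxl j)
  refine ⟨⟨fun j => x j, fun j => Nat.cast_pos.2 (hxp j).pos, ?_⟩, ?_⟩
  · simpa using congrArg (Int.cast : ℤ → ℝ) hsum
  intro p hp
  by_cases hmem : ∃ j, x j = p
  · obtain ⟨j, rfl⟩ := hmem
    refine solZpUnit_of_not_dvd (by omega) hs ?_ a fun i hdvd => ?_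
    · have : (16 * (k : ℝ) ^ 6) < x j := by linarith [hlt j]
      exact_mod_cast this
    · have h1 : x j ≤ (a i).natAbs :=
        Nat.le_of_dvd (Int.natAbs_pos.2 (ha i)) (Int.natCast_dvd.1 hdvd)
      have h2 : (a i).natAbs ≤ Finset.univ.sup fun j => (a j).natAbs :=
        Finset.le_sup (f := fun j => (a j).natAbs) (Finset.mem_univ i)
      have h3 : (Finset.univ.sup fun j => (a j).natAbs) < x j := Nat.cast_lt.1 (hlt j)
      omega
  · push Not at hmem
    refine ⟨fun j => x j, fun j => ?_, by simpa using congrArg (Int.cast : ℤ → ℤ_[p]) hsum⟩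
    rw [PadicInt.isUnit_iff, PadicInt.norm_natCast_eq_one_iff]
    exact (Nat.coprime_primes hp.out (hxp j)).2 (hmem j).symm
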